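/- With x⁺ := p_ℓ(x,y,μ), for every i = 1,…,m: F̃_i(x, μ) − F̃_i(x⁺, μ) ≥ (ℓ/2) · [2⟨x⁺ − y, y − x⟩ + ‖x⁺ − y‖²]. -/

import Mathlib

open scoped RealInnerProductSpace

/-- The function `φ_ℓ(·; x, y, μ)` of the subproblem, with `ftil i = f̃ᵢ(·, μ)` for the
fixed smoothing parameter `μ`. -/
noncomputable def phiSub (n m : ℕ) (g ftil : Fin m → EuclideanSpace ℝ (Fin n) → ℝ)
    (x y : EuclideanSpace ℝ (Fin n)) (ℓ : ℝ) (z : EuclideanSpace ℝ (Fin n)) : ℝ :=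
  (⨆ i : Fin m, (⟪gradient (ftil i) y, z - y⟫ + g i z + ftil i y
      - (ftil i x + g i x))) + ℓ / 2 * ‖z - y‖ ^ 2

lemma aux_line {E : Type*} [NormedAddCommGroup E] [InnerProductSpace ℝ E] [CompleteSpace E]
    (f : E → ℝ) (hf : Differentiable ℝ f) (y d : E) (t : ℝ) :
    HasDerivAt (fun t : ℝ => f (y + t • d)) ⟪gradient f (y + t • d), d⟫ t := by
  have h1 := (hf (y + t • d)).hasGradientAt.hasFDerivAt
  have h2 : HasDerivAt (fun t : ℝ => y + t • d) d t := by
    simpa using ((hasDerivAt_id t).smul_const d).const_add y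
  have h3 := h1.comp_hasDerivAt t h2
  rw [InnerProductSpace.toDual_apply_apply] at h3
  exact h3

lemma aux_convex {E : Type*} [NormedAddCommGroup E] [InnerProductSpace ℝ E] [CompleteSpace E]
    (f : E → ℝ) (hf : Differentiable ℝ f) (hc : ConvexOn ℝ Set.univ f) (y x : E) :
    ⟪gradient f y, x - y⟫ + f y ≤ f x := by
  have hl := aux_line f hf y (x - y) 0
  have hcl : ConvexOn ℝ Set.univ (fun t : ℝ => f (y + t • (x - y))) := by
    have := hc.comp_affineMap (AffineMap.lineMap (k := ℝ) y x)
    simpa [Function.comp_def, AffineMap.lineMap_apply, add_comm] using this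
  have := hcl.le_slope_of_hasDerivAt (Set.mem_univ 0) (Set.mem_univ 1) one_pos hl
  simp only [slope_def_field, zero_smul, one_smul, add_zero, add_sub_cancel, sub_zero, div_one] at this
  linarith

lemma aux_descent {E : Type*} [NormedAddCommGroup E] [InnerProductSpace ℝ E] [CompleteSpace E]
    (f : E → ℝ) (hf : Differentiable ℝ f) (l : ℝ) (hl : 0 < l)
    (hlip : LipschitzWith (Real.toNNReal l) (fun w => gradient f w)) (y x : E) :
    f x ≤ ⟪gradient f y, x - y⟫ + f y + l / 2 * ‖x - y‖ ^ 2 := by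
  set d := x - y with hd
  have hder : ∀ t : ℝ, HasDerivAt
      (fun t : ℝ => f (y + t • d) - t * ⟪gradient f y, d⟫ - t ^ 2 * (l / 2 * ‖d‖ ^ 2))
      (⟪gradient f (y + t • d), d⟫ - ⟪gradient f y, d⟫ - (2 * t) * (l / 2 * ‖d‖ ^ 2)) t := by
    intro t
    have h1 := aux_line f hf y d t
    have h2 := (hasDerivAt_id t).mul_const ⟪gradient f y, d⟫
    have h3 := (hasDerivAt_pow 2 t).mul_const (l / 2 * ‖d‖ ^ 2)
    have h4 := (h1.sub h2).sub h3
    refine h4.congr_deriv ?_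
    norm_num
  have hanti := antitoneOn_of_deriv_nonpos (convex_Icc (0 : ℝ) 1)
    (fun t _ => (hder t).continuousAt.continuousWithinAt)
    (fun t _ => (hder t).differentiableAt.differentiableWithinAt) (by
      intro t ht
      rw [interior_Icc] at ht
      rw [(hder t).deriv, ← inner_sub_left]
      have h1 := real_inner_le_norm (gradient f (y + t • d) - gradient f y) d
      have h2 := hlip.dist_le_mul (y + t • d) y
      rw [dist_eq_norm, dist_eq_norm, Real.coe_toNNReal _ hl.le, add_sub_cancel_left, norm_smul,
        Real.norm_of_nonneg ht.1.le] at h2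
      have h3 := mul_le_mul_of_nonneg_right h2 (norm_nonneg d)
      nlinarith)
  have := hanti (by simp : (0 : ℝ) ∈ Set.Icc (0 : ℝ) 1) (by simp : (1 : ℝ) ∈ Set.Icc (0 : ℝ) 1)
    zero_le_one
  have hxy : y + d = x := by rw [hd]; abel
  simp only [zero_smul, one_smul, add_zero, hxy] at this
  linarith

/-- with `x⁺ := p_ℓ(x,y,μ)` the minimizer of the subproblem, for every `i`,
`F̃ᵢ(x, μ) − F̃ᵢ(x⁺, μ) ≥ (ℓ/2)[2⟨x⁺ − y, y − x⟩ + ‖x⁺ − y‖²]`. -/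
theorem stmt_13 (n m : ℕ) (hn : 1 ≤ n) (hm : 1 ≤ m)
    (g ftil : Fin m → EuclideanSpace ℝ (Fin n) → ℝ) (μ : ℝ) (hμ : 0 < μ)
    (ℓ : ℝ) (hℓ : 0 < ℓ)
    (hg : ∀ i, ConvexOn ℝ Set.univ (g i))
    (hf : ∀ i, ConvexOn ℝ Set.univ (ftil i))
    (hf' : ∀ i, ContDiff ℝ 1 (ftil i))
    (hlip : ∀ i, LipschitzWith (Real.toNNReal ℓ) (fun w => gradient (ftil i) w))
    (x y xplus : EuclideanSpace ℝ (Fin n))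
    (hmin : ∀ w : EuclideanSpace ℝ (Fin n),
      phiSub n m g ftil x y ℓ xplus ≤ phiSub n m g ftil x y ℓ w) :
    ∀ i : Fin m, (ftil i x + g i x) - (ftil i xplus + g i xplus) ≥
      ℓ / 2 * (2 * ⟪xplus - y, y - x⟫ + ‖xplus - y‖ ^ 2) := by
  intro i
  have : Nonempty (Fin m) := ⟨i⟩
  have hd : ∀ j, Differentiable ℝ (ftil j) := fun j => (hf' j).differentiable (by simp)
  set h : Fin m → EuclideanSpace ℝ (Fin n) → ℝ := fun j z =>
    ⟪gradient (ftil j) y, z - y⟫ + g j z + ftil j y - (ftil j x + g j x) with hh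
  have hphi : ∀ z, phiSub n m g ftil x y ℓ z = (⨆ j, h j z) + ℓ / 2 * ‖z - y‖ ^ 2 :=
    fun z => rfl
  have hle : ∀ j z, h j z ≤ ⨆ k, h k z := fun j z =>
    le_ciSup (f := fun k => h k z) (Set.finite_range _).bddAbove j
  have hx0 : ∀ j, h j x ≤ 0 := by
    intro j
    have := aux_convex (ftil j) (hd j) (hf j) y x
    simp only [hh]
    linarith
  set S := ⨆ k, h k xplus with hS
  set a := xplus - y with ha
  set b := x - xplus with hb
  -- the inequality along the segment
  have key : ∀ t : ℝ, 0 < t → t < 1 → S ≤ ℓ * ⟪a, b⟫ + t * (ℓ / 2 * ‖b‖ ^ 2) := by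
    intro t ht0 ht1
    have h1 := hmin (xplus + t • b)
    rw [hphi, hphi] at h1
    have h2 : (⨆ j, h j (xplus + t • b)) ≤ (1 - t) * S := by
      apply ciSup_le
      intro j
      have hw : xplus + t • b = (1 - t) • xplus + t • x := by rw [hb]; module
      have hgj := (hg j).2 (Set.mem_univ xplus) (Set.mem_univ x) (sub_nonneg.2 ht1.le) ht0.le
        (by ring)
      rw [← hw] at hgj
      simp only [smul_eq_mul] at hgj
      have hin : ⟪gradient (ftil j) y, xplus + t • b - y⟫ =
          (1 - t) * ⟪gradient (ftil j) y, xplus - y⟫ + t * ⟪gradient (ftil j) y, x - y⟫ := by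
        rw [← real_inner_smul_right, ← real_inner_smul_right, ← inner_add_right]
        congr 1
        rw [hb]; module
      have hconv : h j (xplus + t • b) ≤ (1 - t) * h j xplus + t * h j x := by
        simp only [hh]
        rw [hin]
        linarith
      have h3 := mul_le_mul_of_nonneg_left (hle j xplus) (sub_nonneg.2 ht1.le)
      have h4 := mul_le_mul_of_nonneg_left (hx0 j) ht0.le
      linarith
    have h5 : ‖xplus + t • b - y‖ ^ 2 = ‖a‖ ^ 2 + 2 * t * ⟪a, b⟫ + t ^ 2 * ‖b‖ ^ 2 := by
      have : xplus + t • b - y = a + t • b := by rw [ha]; module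
      rw [this, norm_add_sq_real, inner_smul_right, norm_smul, mul_pow, Real.norm_eq_abs, sq_abs]
      ring
    rw [h5] at h1
    have h6 : t * S ≤ t * (ℓ * ⟪a, b⟫ + t * (ℓ / 2 * ‖b‖ ^ 2)) := by
      linarith
    exact le_of_mul_le_mul_left h6 ht0
  have hlim : S ≤ ℓ * ⟪a, b⟫ := by
    have ht : Filter.Tendsto (fun t : ℝ => ℓ * ⟪a, b⟫ + t * (ℓ / 2 * ‖b‖ ^ 2))
        (nhdsWithin 0 (Set.Ioi 0)) (nhds (ℓ * ⟪a, b⟫ + 0 * (ℓ / 2 * ‖b‖ ^ 2))) :=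
      (Continuous.tendsto (by fun_prop) 0).mono_left nhdsWithin_le_nhds
    rw [zero_mul, add_zero] at ht
    refine ge_of_tendsto ht ?_
    filter_upwards [Ioo_mem_nhdsGT (zero_lt_one' ℝ)] with t ht
    exact key t ht.1 ht.2
  have hdes := aux_descent (ftil i) (hd i) ℓ hℓ (hlip i) y xplus
  have hi := hle i xplus
  simp only [hh] at hi
  have hab : ⟪a, b⟫ = - ⟪a, y - x⟫ - ‖a‖ ^ 2 := by
    rw [← real_inner_self_eq_norm_sq, ← inner_neg_right, ← inner_sub_right]
    congr 1
    rw [ha, hb]; module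
  rw [hab] at hlim
  linarith
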